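/- There exists n₀ such that for all integers n ≥ n₀ and all integers k, r with k+1 < r ≤ 2k, 3 ≤ r and r, k ≤ 0.01·log₂ n, the number of r-element collinear subsets of the grid [n]^k = {1,…,n}^k ⊆ ℝ^k satisfies k·C(n,r)·n^{k-1} ≤ e(H) ≤ (k·2^{r+k+1}/r!)·n^{r+k-1}, where e(H) denotes the number of r-element subsets of [n]^k contained in a single line and C(n,r) is the binomial coefficient. -/

import Mathlib

/-- A line in ℝᵏ: a one-dimensional affine subspace, viewed as a set of points. -/
def IsLine {k : ℕ} (L : Set (Fin k → ℝ)) : Prop :=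
  ∃ u v : Fin k → ℝ, v ≠ 0 ∧ L = {p | ∃ t : ℝ, p = u + t • v}

/-- The grid [n]^k = {1, …, n}^k viewed as a subset of ℝᵏ. -/
def gridPts (n k : ℕ) : Set (Fin k → ℝ) :=
  {p | ∀ i, ∃ m : ℕ, 1 ≤ m ∧ m ≤ n ∧ p i = m}

/-- e(H(n,k,r)): the number of r-element subsets of the grid [n]^k contained in a single line. -/
noncomputable def eH (n k r : ℕ) : ℕ :=
  {T : Set (Fin k → ℝ) | T ⊆ gridPts n k ∧ T.ncard = r ∧
    ∃ L : Set (Fin k → ℝ), IsLine L ∧ T ⊆ L}.ncard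

lemma gridPts_finite (n k : ℕ) : (gridPts n k).Finite := by
  have : gridPts n k ⊆ Set.pi Set.univ (fun _ : Fin k => ((fun m : ℕ => (m : ℝ)) '' (Set.Icc 1 n))) := by
    intro p hp i _
    obtain ⟨m, h1, h2, h3⟩ := hp i
    exact ⟨m, ⟨h1, h2⟩, h3.symm⟩
  exact (Set.Finite.pi' (fun _ => (Set.finite_Icc 1 n).image _)).subset
    (fun p hp i => this hp i trivial)

lemma edges_finite (n k r : ℕ) : {T : Set (Fin k → ℝ) | T ⊆ gridPts n k ∧ T.ncard = r ∧
    ∃ L : Set (Fin k → ℝ), IsLine L ∧ T ⊆ L}.Finite :=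
  ((gridPts_finite n k).finite_subsets).subset (fun _ h => h.1)

/-- axis-parallel collinear set -/
noncomputable def axSet {k : ℕ} (q : Fin k × (Fin k → ℕ) × Finset ℕ) : Set (Fin k → ℝ) :=
  (fun m : ℕ => fun j => ((Function.update q.2.1 q.1 m j : ℕ) : ℝ)) '' (q.2.2 : Set ℕ)

/-- index set of axis-parallel collinear sets -/
noncomputable def axIdx (n k r : ℕ) : Finset (Fin k × (Fin k → ℕ) × Finset ℕ) :=
  Finset.univ.biUnion (fun i : Fin k => {i} ×ˢ
    (Fintype.piFinset (fun j => if j = i then {1} else Finset.Icc 1 n) ×ˢ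
      Finset.powersetCard r (Finset.Icc 1 n)))

lemma pi_card {k : ℕ} (i : Fin k) {α : Type*} [DecidableEq α] (a : α) (A : Finset α) :
    (Fintype.piFinset (fun j : Fin k => if j = i then {a} else A)).card = A.card ^ (k - 1) := by
  rw [Fintype.card_piFinset, ← Finset.mul_prod_erase Finset.univ _ (Finset.mem_univ i)]
  rw [Finset.prod_congr rfl (g := fun _ => A.card)]
  · simp
  · intro j hj
    simp [Finset.ne_of_mem_erase hj]

lemma axIdx_card (n k r : ℕ) : (axIdx n k r).card = k * n.choose r * n ^ (k - 1) := by
  unfold axIdx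
  rw [Finset.card_biUnion]
  · simp only [Finset.card_product, pi_card]
    simp
    ring
  · intro i _ j _ hij
    rw [Function.onFun, Finset.disjoint_left]
    rintro ⟨a, b⟩ h1 h2
    simp only [Finset.mem_product, Finset.mem_singleton] at h1 h2
    exact hij (h1.1.symm.trans h2.1)

lemma axIdx_mem {n k r : ℕ} {i : Fin k} {x : Fin k → ℕ} {S : Finset ℕ} :
    (i, x, S) ∈ axIdx n k r ↔ (x i = 1 ∧ ∀ j, j ≠ i → 1 ≤ x j ∧ x j ≤ n) ∧
      (∀ m ∈ S, 1 ≤ m ∧ m ≤ n) ∧ S.card = r := by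
  unfold axIdx
  simp only [Finset.mem_biUnion, Finset.mem_univ, true_and, Finset.mem_product,
    Finset.mem_singleton, Fintype.mem_piFinset, Finset.mem_powersetCard]
  constructor
  · rintro ⟨a, rfl, h1, h2, h3⟩
    refine ⟨⟨by simpa using h1 i, fun j hj => by simpa [hj] using h1 j⟩, fun m hm => by
      simpa using h2 hm, h3⟩
  · rintro ⟨⟨h1, h2⟩, h3, h4⟩
    refine ⟨i, rfl, fun j => ?_, fun m hm => by simpa using h3 m hm, h4⟩
    by_cases hj : j = i
    · subst hj; simp [h1]
    · simpa [hj] using h2 j hj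

lemma axSet_sub {k : ℕ} {i i' : Fin k} {x x' : Fin k → ℕ} {S S' : Finset ℕ}
    (hx : x i = 1) (hx' : x' i' = 1) (hS : 2 ≤ S.card)
    (h : axSet (i, x, S) ⊆ axSet (i', x', S')) : i = i' ∧ x = x' ∧ S ⊆ S' := by
  have key : ∀ m ∈ S, ∃ m' ∈ S', Function.update x i m = Function.update x' i' m' := by
    intro m hm
    obtain ⟨m', h1, h2⟩ := h ⟨m, hm, rfl⟩
    refine ⟨m', h1, ?_⟩
    funext j
    have := congrFun h2 j
    simp only at this
    exact_mod_cast this.symm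
  obtain ⟨a, ha, b, hb, hab⟩ := Finset.one_lt_card.1 hS
  obtain ⟨a', ha', ea⟩ := key a ha
  obtain ⟨b', hb', eb⟩ := key b hb
  have hi : i = i' := by
    by_contra hne
    have e1 := congrFun ea i
    have e2 := congrFun eb i
    simp [hne] at e1 e2
    exact hab (e1.trans e2.symm)
  subst hi
  refine ⟨rfl, ?_, ?_⟩
  · funext j
    by_cases hj : j = i
    · subst hj; rw [hx, hx']
    · have e1 := congrFun ea j
      simpa [hj] using e1
  · intro m hm
    obtain ⟨m', hm', e⟩ := key m hm
    have e1 := congrFun e i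
    simp at e1
    rwa [e1]

lemma lower (n k r : ℕ) (hr : 3 ≤ r) : k * n.choose r * n ^ (k - 1) ≤ eH n k r := by
  classical
  rw [← axIdx_card, ← Finset.card_image_of_injOn (f := axSet), ← Set.ncard_coe_finset]
  · unfold eH
    apply Set.ncard_le_ncard _ (edges_finite n k r)
    intro T hT
    rw [Finset.mem_coe, Finset.mem_image] at hT
    obtain ⟨⟨i, x, S⟩, hq, rfl⟩ := hT
    rw [axIdx_mem] at hq
    obtain ⟨⟨h1, h2⟩, h3, h4⟩ := hq
    refine ⟨?_, ?_, {p | ∃ t : ℝ, p = (fun j => ((Function.update x i 0 j : ℕ) : ℝ)) +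
        t • (Pi.single i 1 : Fin k → ℝ)}, ⟨_, _, ?_, rfl⟩, ?_⟩
    · rintro _ ⟨m, hm, rfl⟩ j
      by_cases hj : j = i
      · subst hj
        exact ⟨m, (h3 m hm).1, (h3 m hm).2, by simp⟩
      · exact ⟨x j, (h2 j hj).1, (h2 j hj).2, by simp [hj]⟩
    · unfold axSet
      rw [Set.ncard_image_of_injective, Set.ncard_coe_finset, h4]
      intro a b hab
      have := congrFun hab i
      simpa using this
    · intro h
      have := congrFun h i
      simp at this
    · rintro _ ⟨m, hm, rfl⟩
      refine ⟨m, ?_⟩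
      funext j
      by_cases hj : j = i
      · subst hj; simp
      · simp [hj]
  · rintro ⟨i, x, S⟩ hq ⟨i', x', S'⟩ hq' h
    rw [Finset.mem_coe, axIdx_mem] at hq hq'
    obtain ⟨e1, e2, e3⟩ := axSet_sub hq.1.1 hq'.1.1 (by omega) h.le
    obtain ⟨_, _, e4⟩ := axSet_sub hq'.1.1 hq.1.1 (by omega) h.ge
    rw [e1, e2, Finset.Subset.antisymm e3 e4]

/-- collinear set from base point, direction and multiples -/
noncomputable def colSet {k : ℕ} (q : (Fin k → ℤ) × (Fin k → ℤ) × Finset ℕ) : Set (Fin k → ℝ) :=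
  (fun t : ℕ => fun j => (q.1 j : ℝ) + t * (q.2.1 j : ℝ)) '' (insert 0 (q.2.2 : Set ℕ))

/-- index set for direction of max coordinate `i` equal to `s` -/
noncomputable def colIdx (n k r : ℕ) (i : Fin k) (s : ℕ) :
    Finset ((Fin k → ℤ) × (Fin k → ℤ) × Finset ℕ) :=
  Fintype.piFinset (fun _ => Finset.Icc (1 : ℤ) n) ×ˢ
    (Fintype.piFinset (fun j => if j = i then {(s : ℤ)} else Finset.Icc (-(s : ℤ)) s) ×ˢ
      Finset.powersetCard (r - 1) (Finset.Icc 1 (n / s)))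

lemma colIdx_card (n k r : ℕ) (i : Fin k) (s : ℕ) :
    (colIdx n k r i s).card = n ^ k * ((2 * s + 1) ^ (k - 1) * (n / s).choose (r - 1)) := by
  unfold colIdx
  simp only [Finset.card_product, pi_card]
  simp
  left; left
  congr 1
  omega

/-- existence of the smallest integral multiple -/
lemma exists_dir {k : ℕ} (i : Fin k) (v : Fin k → ℝ) (hi : v i = 1) (hv : ∀ j, |v j| ≤ 1)
    (a : ℤ) (ha : a ≠ 0) (hav : ∀ j, ∃ b : ℤ, (a : ℝ) * v j = b) :
    ∃ (s : ℕ) (d : Fin k → ℤ), 0 < s ∧ d i = s ∧ (∀ j, |d j| ≤ s) ∧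
      ∀ c : ℤ, (∀ j, ∃ b : ℤ, (c : ℝ) * v j = b) → ∃ t : ℤ, c = t * s ∧ 
        ∀ j, (c : ℝ) * v j = t * d j := by
  let G : AddSubgroup ℤ :=
    { carrier := {c | ∀ j, ∃ b : ℤ, (c : ℝ) * v j = b}
      zero_mem' := fun j => ⟨0, by simp⟩
      add_mem' := by
        intro x y hx hy j
        obtain ⟨b, hb⟩ := hx j
        obtain ⟨b', hb'⟩ := hy j
        exact ⟨b + b', by push_cast; rw [add_mul, hb, hb']⟩
      neg_mem' := by
        intro x hx j
        obtain ⟨b, hb⟩ := hx j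
        exact ⟨-b, by push_cast; rw [neg_mul, hb]⟩ }
  obtain ⟨g, hg⟩ := Int.subgroup_cyclic G
  have hmem : ∀ c : ℤ, (∀ j, ∃ b : ℤ, (c : ℝ) * v j = b) ↔ g ∣ c := by
    intro c
    have : c ∈ G ↔ g ∣ c := by
      rw [hg, AddSubgroup.mem_closure_singleton]
      constructor
      · rintro ⟨z, rfl⟩; exact ⟨z, by simp [mul_comm]⟩
      · rintro ⟨z, rfl⟩; exact ⟨z, by simp [mul_comm]⟩
    exact this
  have hg0 : g ≠ 0 := by
    rintro rfl
    exact ha (zero_dvd_iff.1 ((hmem a).1 hav))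
  have hs := (hmem (g.natAbs : ℤ)).2 (by simp)
  choose d hd using hs
  have hpos : 0 < g.natAbs := Int.natAbs_pos.2 hg0
  refine ⟨g.natAbs, d, hpos, ?_, ?_, ?_⟩
  · have := hd i
    rw [hi, mul_one] at this
    exact_mod_cast this.symm
  · intro j
    have h1 := hd j
    have h2 : |(d j : ℝ)| ≤ ((g.natAbs : ℕ) : ℝ) := by
      rw [← h1, abs_mul]
      have : |(((g.natAbs : ℕ) : ℤ) : ℝ)| = ((g.natAbs : ℕ) : ℝ) := by
        rw [Int.cast_natCast, abs_of_nonneg (Nat.cast_nonneg _)]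
      rw [this]
      exact mul_le_of_le_one_right (Nat.cast_nonneg _) (hv j)
    have h3 : ((|d j| : ℤ) : ℝ) ≤ (((g.natAbs : ℕ) : ℤ) : ℝ) := by
      rw [Int.cast_abs, Int.cast_natCast]; exact h2
    exact Int.cast_le.1 h3
  · intro c hc
    have := (hmem c).1 hc
    obtain ⟨t, ht⟩ := (Int.natAbs_dvd.2 this)
    refine ⟨t, by rw [ht, mul_comm], fun j => ?_⟩
    rw [← hd j, ht]; push_cast; ring

lemma edge_mem {n k r : ℕ} (hr : 3 ≤ r) (T : Set (Fin k → ℝ)) (hT : T ⊆ gridPts n k)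
    (hc : T.ncard = r) (hL : ∃ L : Set (Fin k → ℝ), IsLine L ∧ T ⊆ L) :
    ∃ i : Fin k, ∃ s ∈ Finset.Icc 1 n, ∃ q ∈ colIdx n k r i s, colSet q = T := by
  obtain ⟨_, ⟨u, v, hv, rfl⟩, hTL⟩ := hL
  have hfin : T.Finite := (gridPts_finite n k).subset hT
  obtain ⟨i0, hi0⟩ := Function.ne_iff.1 hv
  obtain ⟨i, -, hi⟩ := Finset.exists_max_image Finset.univ (fun j => |v j|) ⟨i0, Finset.mem_univ _⟩
  have hvi : v i ≠ 0 := by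
    have h1 := hi i0 (Finset.mem_univ _)
    have h2 : 0 < |v i0| := abs_pos.2 hi0
    exact abs_pos.1 (lt_of_lt_of_le h2 h1)
  have hne : T.Nonempty := by
    apply Set.nonempty_of_ncard_ne_zero; omega
  obtain ⟨p, hp, hpmin⟩ := Set.exists_min_image T (fun q => q i) hfin hne
  set w : Fin k → ℝ := fun j => v j / v i with hw
  have hwi : w i = 1 := by simp [hw, hvi]
  have hwj : ∀ j, |w j| ≤ 1 := by
    intro j
    simp only [hw, abs_div]
    exact div_le_one_of_le₀ (hi j (Finset.mem_univ _)) (abs_nonneg _)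
  have hdiff : ∀ q ∈ T, ∀ j, q j - p j = (q i - p i) * w j := by
    intro q hq j
    obtain ⟨t, rfl⟩ := hTL hq
    obtain ⟨t', rfl⟩ := hTL hp
    simp only [hw, Pi.add_apply, Pi.smul_apply, smul_eq_mul]
    field_simp
    ring
  have hint : ∀ q ∈ T, ∃ z : Fin k → ℤ, ∀ j, 1 ≤ z j ∧ z j ≤ n ∧ q j = z j := by
    intro q hq
    have := hT hq
    choose m h1 h2 h3 using this
    exact ⟨fun j => m j, fun j => ⟨Nat.one_le_cast.2 (h1 j), Nat.cast_le.2 (h2 j), by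
      rw [h3 j]; simp⟩⟩
  obtain ⟨zp, hzp⟩ := hint p hp
  obtain ⟨q0, hq0, hq0p⟩ := Set.exists_ne_of_one_lt_ncard (s := T) (by omega) p
  have hcoef : ∀ q ∈ T, ∀ z : Fin k → ℤ, (∀ j, 1 ≤ z j ∧ z j ≤ n ∧ q j = z j) →
      ∀ j, ((z i - zp i : ℤ) : ℝ) * w j = ((z j - zp j : ℤ) : ℝ) := by
    intro q hq z hz j
    have := hdiff q hq j
    rw [(hz j).2.2, (hz i).2.2, (hzp i).2.2, (hzp j).2.2] at this
    push_cast; exact this.symm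
  obtain ⟨z0, hz0⟩ := hint q0 hq0
  have ha : z0 i - zp i ≠ 0 := by
    intro h
    apply hq0p
    funext j
    have := hcoef q0 hq0 z0 hz0 j
    rw [h, Int.cast_zero, zero_mul] at this
    have h2 : z0 j - zp j = 0 := by exact_mod_cast this.symm
    rw [(hz0 j).2.2, (hzp j).2.2]
    have : z0 j = zp j := by omega
    rw [this]
  obtain ⟨s, d, hs, hdi, hdj, hall⟩ := exists_dir i w hwi hwj _ ha
    (fun j => ⟨_, hcoef q0 hq0 z0 hz0 j⟩)
  -- each point is p + t d
  have hrep : ∀ q ∈ T, ∃ t : ℕ, t * s < n ∧ ∀ j, q j = (zp j : ℝ) + t * (d j : ℝ) := by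
    intro q hq
    obtain ⟨z, hz⟩ := hint q hq
    obtain ⟨t, h1, h2⟩ := hall (z i - zp i) (fun j => ⟨_, hcoef q hq z hz j⟩)
    have hmin : zp i ≤ z i := by
      have := hpmin q hq
      rw [(hz i).2.2, (hzp i).2.2] at this
      exact_mod_cast this
    have ht : 0 ≤ t := by
      by_contra hlt
      push Not at hlt
      have : t * (s : ℤ) < 0 := mul_neg_of_neg_of_pos hlt (by exact_mod_cast hs)
      omega
    lift t to ℕ using ht
    refine ⟨t, ?_, fun j => ?_⟩
    · have := (hz i).2.1
      have := (hzp i).1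
      have : ((t * s : ℕ) : ℤ) < n := by push_cast; omega
      exact_mod_cast this
    · have h3 := hcoef q hq z hz j
      rw [h2 j] at h3
      rw [(hz j).2.2]
      push_cast at h3
      linarith
  let F : ℕ → Fin k → ℝ := fun t j => (zp j : ℝ) + t * (d j : ℝ)
  have hF : Function.Injective F := by
    intro a b hab
    have := congrFun hab i
    simp only [F, hdi] at this
    have hs' : (s : ℝ) ≠ 0 := by positivity
    have h3 : (a : ℝ) * s = b * s := by
      have : (a:ℝ) * ((s:ℤ):ℝ) = b * ((s:ℤ):ℝ) := by linarith
      simpa using this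
    exact_mod_cast mul_right_cancel₀ hs' h3
  have hF0 : F 0 = p := by
    funext j; simp [F, (hzp j).2.2]
  have hpre : (F ⁻¹' T).Finite := hfin.preimage hF.injOn
  have hFim : F '' (F ⁻¹' T) = T := by
    apply Set.image_preimage_eq_of_subset
    intro q hq
    obtain ⟨t, -, ht⟩ := hrep q hq
    exact ⟨t, by funext j; exact (ht j).symm⟩
  have hcard : hpre.toFinset.card = r := by
    rw [← Set.ncard_eq_toFinset_card _ hpre, ← hc, ← Set.ncard_image_of_injective _ hF, hFim]
  have h0mem : 0 ∈ hpre.toFinset := by simp [hF0, hp]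
  have hbd : ∀ t ∈ hpre.toFinset, t * s < n := by
    intro t ht
    have ht' : F t ∈ T := by simpa using ht
    obtain ⟨t', h1, h2⟩ := hrep _ ht'
    have : F t = F t' := by funext j; exact h2 j
    rw [hF this]; exact h1
  have hsn : s ≤ n := by
    obtain ⟨t, ht, h0⟩ := Finset.exists_mem_ne (s := hpre.toFinset) (by omega) 0
    have h1 := hbd t ht
    have h2 : 1 ≤ t := Nat.one_le_iff_ne_zero.2 h0
    nlinarith
  refine ⟨i, s, Finset.mem_Icc.2 ⟨hs, hsn⟩, (zp, d, hpre.toFinset.erase 0), ?_, ?_⟩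
  · unfold colIdx
    simp only [Finset.mem_product, Fintype.mem_piFinset, Finset.mem_powersetCard]
    refine ⟨fun j => Finset.mem_Icc.2 ⟨(hzp j).1, (hzp j).2.1⟩, fun j => ?_, ?_, ?_⟩
    · by_cases hj : j = i
      · subst hj; simp [hdi]
      · simp only [hj, if_false, Finset.mem_Icc]
        exact abs_le.1 (hdj j)
    · intro t ht
      rw [Finset.mem_erase] at ht
      rw [Finset.mem_Icc]
      exact ⟨Nat.one_le_iff_ne_zero.2 ht.1, (Nat.le_div_iff_mul_le hs).2 (hbd t ht.2).le⟩
    · rw [Finset.card_erase_of_mem h0mem, hcard]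
  · unfold colSet
    simp only
    rw [← Finset.coe_insert, Finset.insert_erase h0mem, Set.Finite.coe_toFinset]
    exact hFim

lemma upper_nat (n k r : ℕ) (hr : 3 ≤ r) : eH n k r ≤
    k * ∑ s ∈ Finset.Icc 1 n, n ^ k * ((2 * s + 1) ^ (k - 1) * (n / s).choose (r - 1)) := by
  classical
  let A : Finset (Set (Fin k → ℝ)) := Finset.univ.biUnion fun i : Fin k =>
    (Finset.Icc 1 n).biUnion fun s => (colIdx n k r i s).image colSet
  have h1 : eH n k r ≤ A.card := by
    rw [← Set.ncard_coe_finset]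
    apply Set.ncard_le_ncard _ A.finite_toSet
    rintro T ⟨a, b, c⟩
    obtain ⟨i, s, hs, q, hq, h⟩ := edge_mem hr T a b c
    simp only [A, Finset.mem_coe, Finset.mem_biUnion, Finset.mem_image, Finset.mem_univ, true_and]
    exact ⟨i, s, hs, q, hq, h⟩
  refine h1.trans ?_
  refine Finset.card_biUnion_le.trans ?_
  calc _ ≤ ∑ i : Fin k, ∑ s ∈ Finset.Icc 1 n,
        n ^ k * ((2 * s + 1) ^ (k - 1) * (n / s).choose (r - 1)) := by
        apply Finset.sum_le_sum
        intro i _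
        refine Finset.card_biUnion_le.trans ?_
        apply Finset.sum_le_sum
        intro s _
        rw [← colIdx_card n k r i s]
        exact Finset.card_image_le
    _ = _ := by simp

lemma sum_inv_sq (n : ℕ) : ∑ s ∈ Finset.Icc 1 n, (1 : ℝ) / (s : ℝ) ^ 2 ≤ 2 := by
  have : ∀ m : ℕ, ∑ s ∈ Finset.Icc 1 (m + 1), (1 : ℝ) / (s : ℝ) ^ 2 ≤ 2 - 1 / ((m : ℝ) + 1) := by
    intro m
    induction m with
    | zero => norm_num
    | succ m ih =>
      rw [Finset.sum_Icc_succ_top (by omega)]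
      push_cast
      have h : (1 : ℝ) / ((m : ℝ) + 1 + 1) ^ 2 ≤ 1 / ((m : ℝ) + 1) - 1 / ((m : ℝ) + 1 + 1) := by
        rw [div_sub_div _ _ (by positivity) (by positivity),
          div_le_div_iff₀ (by positivity) (by positivity)]
        have : (0 : ℝ) ≤ m := Nat.cast_nonneg m
        nlinarith
      linarith
  rcases n with _ | m
  · simp
  · refine (this m).trans ?_
    have : (0 : ℝ) ≤ 1 / ((m : ℝ) + 1) := by positivity
    linarith

lemma term_bound (n k r s : ℕ) (hs : 1 ≤ s) (hk : 1 ≤ k) (hkr : k + 1 < r) :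
    (((2 * s + 1) ^ (k - 1) * (n / s).choose (r - 1) : ℕ) : ℝ) ≤
      3 ^ (k - 1) * (n : ℝ) ^ (r - 1) / (r - 1).factorial * (1 / (s : ℝ) ^ 2) := by
  have hs1 : (1 : ℝ) ≤ s := by exact_mod_cast hs
  have h1 : (((n / s).choose (r - 1) : ℕ) : ℝ) ≤ ((n : ℝ) / s) ^ (r - 1) / (r - 1).factorial := by
    refine (Nat.choose_le_pow_div (r - 1) (n / s)).trans ?_
    have : ((n / s : ℕ) : ℝ) ≤ (n : ℝ) / s := Nat.cast_div_le
    gcongr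
  have h2 : ((2 * s + 1 : ℕ) : ℝ) ^ (k - 1) ≤ 3 ^ (k - 1) * (s : ℝ) ^ (k - 1) := by
    rw [← mul_pow]
    apply pow_le_pow_left₀ (by positivity)
    push_cast; linarith
  have h3 : (s : ℝ) ^ (k - 1) * (s : ℝ) ^ 2 ≤ (s : ℝ) ^ (r - 1) := by
    rw [← pow_add]
    exact pow_le_pow_right₀ hs1 (by omega)
  have h4 : (s : ℝ) ^ (k - 1) / (s : ℝ) ^ (r - 1) ≤ 1 / (s : ℝ) ^ 2 := by
    rw [div_le_div_iff₀ (by positivity) (by positivity)]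
    linarith
  calc (((2 * s + 1) ^ (k - 1) * (n / s).choose (r - 1) : ℕ) : ℝ)
      = ((2 * s + 1 : ℕ) : ℝ) ^ (k - 1) * (((n / s).choose (r - 1) : ℕ) : ℝ) := by push_cast; ring
    _ ≤ (3 ^ (k - 1) * (s : ℝ) ^ (k - 1)) * (((n : ℝ) / s) ^ (r - 1) / (r - 1).factorial) := by
        gcongr
    _ = 3 ^ (k - 1) * (n : ℝ) ^ (r - 1) / (r - 1).factorial *
        ((s : ℝ) ^ (k - 1) / (s : ℝ) ^ (r - 1)) := by
        rw [div_pow]; field_simp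
    _ ≤ _ := by gcongr

lemma num_bound (k r : ℕ) (hk : 1 ≤ k) (hkr : k + 1 < r) (hr : r ≤ 2 * k) :
    r * (2 * 3 ^ (k - 1)) ≤ 2 ^ (r + k + 1) := by
  have h1 : ∀ m : ℕ, (m + 1) * 3 ^ m ≤ 2 * 4 ^ m * 2 := by
    intro m
    induction m with
    | zero => norm_num
    | succ m ih =>
      rw [pow_succ, pow_succ]
      have : (m + 1 + 1) * 3 ≤ (m + 4) * 3 := by omega
      have h3 : 3 ^ m ≤ 4 ^ m := Nat.pow_le_pow_left (by norm_num) m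
      generalize 3 ^ m = x at *
      generalize 4 ^ m = y at *
      nlinarith
  obtain ⟨m, rfl⟩ : ∃ m, k = m + 1 := ⟨k - 1, by omega⟩
  simp only [Nat.add_sub_cancel]
  have h2 : 2 ^ (2 * m + 5) ≤ 2 ^ (r + (m + 1) + 1) := Nat.pow_le_pow_right (by norm_num) (by omega)
  have h3 : 2 ^ (2 * m + 5) = 32 * 4 ^ m := by
    rw [pow_add, pow_mul]; norm_num; ring
  have h4 := h1 m
  have h5 : r * (2 * 3 ^ m) ≤ (2 * (m + 1)) * (2 * 3 ^ m) := Nat.mul_le_mul_right _ hr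
  rw [h3] at h2
  refine h5.trans (le_trans ?_ h2)
  generalize 3 ^ m = x at *
  generalize 4 ^ m = y at *
  nlinarith

lemma upper (n k r : ℕ) (hr3 : 3 ≤ r) (hkr : k + 1 < r) (hr : r ≤ 2 * k) :
    (eH n k r : ℝ) ≤ (k : ℝ) * 2 ^ (r + k + 1) / (Nat.factorial r : ℝ) * (n : ℝ) ^ (r + k - 1) := by
  have hk : 1 ≤ k := by omega
  have h1 : (eH n k r : ℝ) ≤ k * ∑ s ∈ Finset.Icc 1 n, (n : ℝ) ^ k *
      (((2 * s + 1) ^ (k - 1) * (n / s).choose (r - 1) : ℕ) : ℝ) := by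
    have := upper_nat n k r hr3
    exact_mod_cast this
  set C : ℝ := 3 ^ (k - 1) * (n : ℝ) ^ (r - 1) / (r - 1).factorial with hC
  have hC0 : 0 ≤ C := by positivity
  have h2 : ∑ s ∈ Finset.Icc 1 n, (n : ℝ) ^ k *
      (((2 * s + 1) ^ (k - 1) * (n / s).choose (r - 1) : ℕ) : ℝ) ≤ (n : ℝ) ^ k * (C * 2) := by
    rw [← Finset.mul_sum]
    gcongr
    calc _ ≤ ∑ s ∈ Finset.Icc 1 n, C * (1 / (s : ℝ) ^ 2) :=
          Finset.sum_le_sum fun s hs => term_bound n k r s (Finset.mem_Icc.1 hs).1 hk hkr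
      _ = C * ∑ s ∈ Finset.Icc 1 n, (1 / (s : ℝ) ^ 2) := by rw [Finset.mul_sum]
      _ ≤ C * 2 := by gcongr; exact sum_inv_sq n
  have h3 : ((r : ℝ) * (2 * 3 ^ (k - 1))) ≤ 2 ^ (r + k + 1) := by
    exact_mod_cast num_bound k r hk hkr hr
  have hfac : (r.factorial : ℝ) = r * (r - 1).factorial := by
    exact_mod_cast (Nat.mul_factorial_pred (by omega : r ≠ 0)).symm
  have hr0 : (r : ℝ) ≠ 0 := by
    have : r ≠ 0 := by omega
    exact_mod_cast this
  have hf0 : ((r - 1).factorial : ℝ) ≠ 0 := by positivity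
  calc (eH n k r : ℝ) ≤ k * ((n : ℝ) ^ k * (C * 2)) := h1.trans (by gcongr)
    _ = (k : ℝ) * (r * (2 * 3 ^ (k - 1))) / (Nat.factorial r : ℝ) * (n : ℝ) ^ (r + k - 1) := by
        rw [hC, hfac, show r + k - 1 = k + (r - 1) by omega, pow_add]
        field_simp
    _ ≤ _ := by gcongr

/-- Claim 4.1(iii) of the paper: if k+1 < r ≤ 2k, 3 ≤ r and r, k ≤ 0.01·log₂ n then
k·C(n,r)·n^(k-1) ≤ e(H(n,k,r)) ≤ (k·2^(r+k+1)/r!)·n^(r+k-1). -/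
theorem collinear_count_r_between_k_and_2k :
    ∃ n₀ : ℕ, ∀ n : ℕ, n₀ ≤ n → ∀ r k : ℕ, k + 1 < r → r ≤ 2 * k → 3 ≤ r →
      (r : ℝ) ≤ 0.01 * Real.logb 2 (n : ℝ) → (k : ℝ) ≤ 0.01 * Real.logb 2 (n : ℝ) →
      (k : ℝ) * (Nat.choose n r : ℝ) * (n : ℝ) ^ (k - 1) ≤ (eH n k r : ℝ) ∧
      (eH n k r : ℝ) ≤ (k : ℝ) * 2 ^ (r + k + 1) / (Nat.factorial r : ℝ) *
        (n : ℝ) ^ (r + k - 1) := by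
  refine ⟨0, fun n _ r k hkr hr hr3 _ _ => ⟨?_, upper n k r hr3 hkr hr⟩⟩
  exact_mod_cast lower n k r hr3
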